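/- Let Λ be an artin algebra, let X ⊂ Y be a Gabriel-Roiter inclusion, and let f = (f_i)_i : X → ⊕_{i=1}^t M_i be a source map for X with all M_i indecomposable. Assume the components f_1, …, f_r are monomorphisms and the remaining components f_{r+1}, …, f_t are not. Then there exist an index i with 1 ≤ i ≤ r and an epimorphism g : M_i → Y such that the composition g∘f_i : X → Y is a monomorphism. -/

import Mathlib

/-!
Setting: `k` is a commutative artinian ring and `Λ` an artin `k`-algebra
(an algebra over `k` which is finitely generated as a `k`-module).
All modules considered are `Λ`-modules of finite length (`IsFiniteLength Λ M`),
and `|M|` denotes the length of `M`, implemented as the height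
`Order.height (⊤ : Submodule Λ M)` of the lattice of submodules
(for a submodule `N` of an ambient module, its length is `Order.height N`).
-/

universe u v

open Submodule

section GRDefs

variable (Λ : Type u) [Ring Λ]

/-- A submodule `N` of an ambient module is indecomposable (as a module):
it is nonzero, and whenever it is the direct sum of two submodules, one of them is zero. -/
def IndecSub {Y : Type v} [AddCommGroup Y] [Module Λ Y] (N : Submodule Λ Y) : Prop :=
  N ≠ ⊥ ∧ ∀ A B : Submodule Λ Y, A ≤ N → B ≤ N → A ⊔ B = N → A ⊓ B = ⊥ → A = ⊥ ∨ B = ⊥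

/-- A module is indecomposable iff its top submodule is. -/
def IndecMod (M : Type v) [AddCommGroup M] [Module Λ M] : Prop :=
  IndecSub Λ (⊤ : Submodule Λ M)

/-- The length `|M|` of a module, as an extended natural number. -/
noncomputable def modLen (M : Type v) [AddCommGroup M] [Module Λ M] : ℕ∞ :=
  Order.height (⊤ : Submodule Λ M)

/-- The length `|N|` of a submodule of an ambient module, as a natural number. -/
noncomputable def subLen {Y : Type v} [AddCommGroup Y] [Module Λ Y] (N : Submodule Λ Y) : ℕ :=
  (Order.height N).toNat

open Classical in
/-- Fuel-based auxiliary function for the Gabriel-Roiter measure. -/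
noncomputable def muAux {Y : Type v} [AddCommGroup Y] [Module Λ Y] :
    ℕ → Submodule Λ Y → ℝ
  | 0, _ => 0
  | n + 1, N =>
      (if IndecSub Λ N then (2 : ℝ) ^ (-(subLen Λ N : ℤ)) else 0)
        + sSup (muAux n '' {N' : Submodule Λ Y | N' < N})

/-- The Gabriel-Roiter measure `μ(N)` of a submodule `N` of an ambient module:
`μ(0) = 0`; if `N ≠ 0` is decomposable, `μ(N)` is the maximum of `μ(N')` over proper
submodules `N'` of `N`; if `N` is indecomposable, `μ(N) = 2^(-|N|)` plus this maximum.
(For modules of finite length the supremum is a maximum and the fuel `|N|` suffices for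
the recursion, so this agrees with the usual inductive definition; the measure of a
submodule depends only on the sublattice of its submodules, hence it does not matter
in which ambient module it is computed.) -/
noncomputable def mu {Y : Type v} [AddCommGroup Y] [Module Λ Y] (N : Submodule Λ Y) : ℝ :=
  muAux Λ (subLen Λ N) N

/-- The Gabriel-Roiter measure of a module. -/
noncomputable def muMod (M : Type v) [AddCommGroup M] [Module Λ M] : ℝ :=
  mu Λ (⊤ : Submodule Λ M)

/-- `X` is a Gabriel-Roiter submodule of the (indecomposable, non-simple) ambient
module `Y`: `X` is an indecomposable proper submodule with `μ(Y) = μ(X) + 2^(-|Y|)`. -/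
def IsGRSub {Y : Type v} [AddCommGroup Y] [Module Λ Y] (X : Submodule Λ Y) : Prop :=
  IndecMod Λ Y ∧ IndecSub Λ X ∧ X ≠ ⊤ ∧
    mu Λ (⊤ : Submodule Λ Y) = mu Λ X + (2 : ℝ) ^ (-(subLen Λ (⊤ : Submodule Λ Y) : ℤ))

/-- A map `u : X → Y` is a Gabriel-Roiter inclusion iff it is injective and its
image is a Gabriel-Roiter submodule of `Y`. -/
def IsGRInclusion {X Y : Type v} [AddCommGroup X] [Module Λ X] [AddCommGroup Y] [Module Λ Y]
    (u : X →ₗ[Λ] Y) : Prop :=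
  Function.Injective u ∧ IsGRSub Λ (LinearMap.range u)

/-- A linear map is a split monomorphism. -/
def IsSplitMonoHom {A B : Type v} [AddCommGroup A] [Module Λ A] [AddCommGroup B] [Module Λ B]
    (f : A →ₗ[Λ] B) : Prop :=
  ∃ g : B →ₗ[Λ] A, g.comp f = LinearMap.id

/-- A linear map is a split epimorphism. -/
def IsSplitEpiHom {A B : Type v} [AddCommGroup A] [Module Λ A] [AddCommGroup B] [Module Λ B]
    (f : A →ₗ[Λ] B) : Prop :=
  ∃ g : B →ₗ[Λ] A, f.comp g = LinearMap.id

/-- A morphism `f` in the category of finite length `Λ`-modules is irreducible if it is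
neither a split monomorphism nor a split epimorphism and, whenever `f = g ∘ h` with the
intermediate module of finite length, either `h` is a split monomorphism or `g` is a
split epimorphism. -/
def IsIrreducibleHom {A B : Type v} [AddCommGroup A] [Module Λ A] [AddCommGroup B] [Module Λ B]
    (f : A →ₗ[Λ] B) : Prop :=
  ¬ IsSplitMonoHom Λ f ∧ ¬ IsSplitEpiHom Λ f ∧
    ∀ (Z : Type v) [AddCommGroup Z] [Module Λ Z], IsFiniteLength Λ Z →
      ∀ (h : A →ₗ[Λ] Z) (g : Z →ₗ[Λ] B), f = g.comp h →
        IsSplitMonoHom Λ h ∨ IsSplitEpiHom Λ g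

/-- An indecomposable submodule `U` of the ambient module is piling provided
`μ(V) ≤ μ(U)` for every indecomposable submodule `V` with `|V| ≤ |U|`. -/
def IsPilingSub {Y : Type v} [AddCommGroup Y] [Module Λ Y] (U : Submodule Λ Y) : Prop :=
  IndecSub Λ U ∧ ∀ V : Submodule Λ Y, IndecSub Λ V →
    Order.height V ≤ Order.height U → mu Λ V ≤ mu Λ U

/-- A Gabriel-Roiter filtration `c 0 ⊂ c 1 ⊂ ⋯ ⊂ c t = N` of an (indecomposable)
submodule `N`: a chain of indecomposable submodules starting at a simple module such
that each inclusion `c i ⊂ c (i+1)` is a Gabriel-Roiter inclusion,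
i.e. `μ(c (i+1)) = μ(c i) + 2^(-|c (i+1)|)`. -/
def IsGRFiltration {Y : Type v} [AddCommGroup Y] [Module Λ Y] {t : ℕ}
    (c : Fin (t + 1) → Submodule Λ Y) (N : Submodule Λ Y) : Prop :=
  c (Fin.last t) = N ∧
  IsSimpleModule Λ (c 0) ∧
  (∀ i : Fin (t + 1), IndecSub Λ (c i)) ∧
  ∀ i : Fin t, c i.castSucc < c i.succ ∧
    mu Λ (c i.succ) = mu Λ (c i.castSucc) + (2 : ℝ) ^ (-(subLen Λ (c i.succ) : ℤ))

/-- A brick: a nonzero module all of whose nonzero endomorphisms are invertible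
(i.e. the endomorphism ring is a division ring). -/
def IsBrick (M : Type v) [AddCommGroup M] [Module Λ M] : Prop :=
  (∃ x : M, x ≠ 0) ∧ ∀ f : M →ₗ[Λ] M, f ≠ 0 → Function.Bijective f

/-- An `M`-filtration `0 = c 0 ⊂ c 1 ⊂ ⋯ ⊂ c m = Y` of the module `Y`
(so `c j` is the module `M[j]`, with `M[0] = 0`, and the `M`-length of `Y` is `m`):
all consecutive factors `c (i+1) / c i` are isomorphic to `M`. -/
structure IsMFiltration (M : Type v) [AddCommGroup M] [Module Λ M]
    {Y : Type v} [AddCommGroup Y] [Module Λ Y] {m : ℕ}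
    (c : Fin (m + 1) → Submodule Λ Y) : Prop where
  bot : c 0 = ⊥
  top : c (Fin.last m) = ⊤
  lt : ∀ i : Fin m, c i.castSucc < c i.succ
  quot : ∀ i : Fin m,
    Nonempty ((↥(c i.succ) ⧸ comap (c i.succ).subtype (c i.castSucc)) ≃ₗ[Λ] M)

/-- A homogeneous `M`-filtration: an `M`-filtration in which moreover all the
`M[i] = c i` with `i ≥ 1` are indecomposable and all the inclusions
`M[i-1] ⊂ M[i]` for `2 ≤ i ≤ m` are irreducible monomorphisms. -/
structure IsHomogMFiltration (M : Type v) [AddCommGroup M] [Module Λ M]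
    {Y : Type v} [AddCommGroup Y] [Module Λ Y] {m : ℕ}
    (c : Fin (m + 1) → Submodule Λ Y) extends IsMFiltration Λ M c : Prop where
  indec : ∀ i : Fin (m + 1), i ≠ 0 → IndecSub Λ (c i)
  irr : ∀ i : Fin m, (i : ℕ) ≠ 0 →
    IsIrreducibleHom Λ (Submodule.inclusion (toIsMFiltration.lt i).le)

end GRDefs

/-- A source map (minimal left almost split morphism) for `X` in the category of finite
length `Λ`-modules: `f : X → M` is not a split monomorphism, every morphism from `X`
that is not a split monomorphism factors through `f`, and every endomorphism `h` of `M`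
with `h ∘ f = f` is an automorphism. -/
def IsSourceMap (Λ : Type u) [Ring Λ] {X M : Type v}
    [AddCommGroup X] [Module Λ X] [AddCommGroup M] [Module Λ M]
    (f : X →ₗ[Λ] M) : Prop :=
  ¬ IsSplitMonoHom Λ f ∧
  (∀ (W : Type v) [AddCommGroup W] [Module Λ W], IsFiniteLength Λ W →
    ∀ g : X →ₗ[Λ] W, ¬ IsSplitMonoHom Λ g → ∃ h : M →ₗ[Λ] W, g = h.comp f) ∧
  (∀ h : M →ₗ[Λ] M, h.comp f = f → Function.Bijective h)

section GabrielRoiterMeasure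

variable {Λ : Type u} [Ring Λ] {Y Z W : Type v}
  [AddCommGroup Y] [Module Λ Y] [AddCommGroup Z] [Module Λ Z] [AddCommGroup W] [Module Λ W]

lemma subLen_eq_length_toNat (N : Submodule Λ Y) :
    subLen Λ N = (Module.length Λ N).toNat := by
  rw [subLen, Module.length_submodule]

lemma subLen_top : subLen Λ (⊤ : Submodule Λ Y) = (Module.length Λ Y).toNat := by
  rw [subLen, Module.length_eq_height]

lemma subLen_lt_subLen [IsNoetherian Λ Y] [IsArtinian Λ Y] {N N' : Submodule Λ Y}
    (h : N' < N) : subLen Λ N' < subLen Λ N := by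
  have h' := Submodule.height_strictMono h
  rw [← ENat.natCast_toNat N'.height_lt_top.ne, ← ENat.natCast_toNat N.height_lt_top.ne] at h'
  exact_mod_cast h'

lemma subLen_map (φ : Z →ₗ[Λ] W) (hφ : Function.Injective φ) (N : Submodule Λ Z) :
    subLen Λ (N.map φ) = subLen Λ N := by
  rw [subLen_eq_length_toNat, subLen_eq_length_toNat,
    (Submodule.equivMapOfInjective φ hφ N).length_eq]

lemma image_map_Iio (φ : Z →ₗ[Λ] W) (hφ : Function.Injective φ) (N : Submodule Λ Z) :
    {N' : Submodule Λ W | N' < N.map φ} = Submodule.map φ '' {N' | N' < N} := by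
  ext A
  constructor
  · intro hA
    have hA' : (A.comap φ).map φ = A := by
      rw [Submodule.map_comap_eq, inf_eq_right]
      exact (le_of_lt hA).trans LinearMap.map_le_range
    refine ⟨A.comap φ, ?_, hA'⟩
    have h : (A.comap φ).map φ < N.map φ := by rw [hA']; exact hA
    exact lt_of_le_not_ge ((Submodule.map_le_map_iff_of_injective hφ _ _).1 h.le)
      fun hle => h.not_ge (Submodule.map_mono hle)
  · rintro ⟨B, hB, rfl⟩
    exact Submodule.map_strictMono_of_injective hφ hB

lemma indecSub_map_iff (φ : Z →ₗ[Λ] W) (hφ : Function.Injective φ) (N : Submodule Λ Z) :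
    IndecSub Λ (N.map φ) ↔ IndecSub Λ N := by
  have hinj := Submodule.map_injective_of_injective hφ
  have hbot : ∀ A : Submodule Λ Z, A.map φ = ⊥ ↔ A = ⊥ := fun A =>
    ⟨fun h => hinj (by rw [h, Submodule.map_bot]), fun h => by rw [h, Submodule.map_bot]⟩
  have hex : ∀ A ≤ N.map φ, ∃ B ≤ N, B.map φ = A := by
    intro A hA
    refine ⟨A.comap φ, ?_, ?_⟩
    · rw [← Submodule.comap_map_eq_of_injective hφ N]
      exact Submodule.comap_mono hA
    · rw [Submodule.map_comap_eq, inf_eq_right]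
      exact hA.trans LinearMap.map_le_range
  constructor
  · rintro ⟨h0, h⟩
    refine ⟨fun e => h0 ((hbot _).2 e), fun A B hA hB hs hi => ?_⟩
    have := h (A.map φ) (B.map φ) (Submodule.map_mono hA) (Submodule.map_mono hB)
      (by rw [← Submodule.map_sup, hs]) (by rw [← Submodule.map_inf φ hφ, hi, Submodule.map_bot])
    simpa only [hbot] using this
  · rintro ⟨h0, h⟩
    refine ⟨fun e => h0 ((hbot _).1 e), fun A B hA hB hs hi => ?_⟩
    obtain ⟨A, hA', rfl⟩ := hex A hA
    obtain ⟨B, hB', rfl⟩ := hex B hB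
    rw [hbot, hbot]
    refine h A B hA' hB' (hinj (by rw [Submodule.map_sup, hs])) (hinj ?_)
    rw [Submodule.map_inf φ hφ, hi, Submodule.map_bot]

lemma muAux_map (φ : Z →ₗ[Λ] W) (hφ : Function.Injective φ) (n : ℕ) (N : Submodule Λ Z) :
    muAux Λ n (N.map φ) = muAux Λ n N := by
  induction n generalizing N with
  | zero => rfl
  | succ n ih =>
    simp only [muAux, subLen_map φ hφ, image_map_Iio φ hφ, Set.image_image, ih]
    by_cases h : IndecSub Λ N
    · rw [if_pos h, if_pos ((indecSub_map_iff φ hφ N).2 h)]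
    · rw [if_neg h, if_neg (mt (indecSub_map_iff φ hφ N).1 h)]

/-- The Gabriel-Roiter measure is preserved by injective maps. -/
lemma mu_map (φ : Z →ₗ[Λ] W) (hφ : Function.Injective φ) (N : Submodule Λ Z) :
    mu Λ (N.map φ) = mu Λ N := by
  rw [mu, mu, subLen_map φ hφ, muAux_map φ hφ]

lemma mu_top_eq_mu_range (φ : Z →ₗ[Λ] W) (hφ : Function.Injective φ) :
    mu Λ (⊤ : Submodule Λ Z) = mu Λ (LinearMap.range φ) := by
  rw [← mu_map φ hφ, Submodule.map_top]

lemma mu_top_quotient_ker (φ : Z →ₗ[Λ] W) :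
    mu Λ (⊤ : Submodule Λ (Z ⧸ LinearMap.ker φ)) = mu Λ (LinearMap.range φ) := by
  rw [mu_top_eq_mu_range ((LinearMap.ker φ).liftQ φ le_rfl), Submodule.range_liftQ]
  exact LinearMap.ker_eq_bot.1 (Submodule.ker_liftQ_eq_bot _ _ _ le_rfl)

lemma mu_top_coe (N : Submodule Λ Y) : mu Λ (⊤ : Submodule Λ N) = mu Λ N := by
  rw [mu_top_eq_mu_range N.subtype N.injective_subtype, Submodule.range_subtype]

lemma muAux_eq_mu [IsNoetherian Λ Y] [IsArtinian Λ Y] (n : ℕ) (N : Submodule Λ Y)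
    (h : subLen Λ N ≤ n) : muAux Λ n N = mu Λ N := by
  suffices H : ∀ (n m : ℕ) (N : Submodule Λ Y), subLen Λ N ≤ n → subLen Λ N ≤ m →
      muAux Λ n N = muAux Λ m N from H n _ N h le_rfl
  have hbot : ∀ (m : ℕ) (N : Submodule Λ Y), subLen Λ N ≤ 0 → muAux Λ m N = 0 := by
    intro m N hN
    obtain rfl : N = ⊥ := by
      by_contra hne
      exact absurd (subLen_lt_subLen (bot_lt_iff_ne_bot.2 hne)) (by omega)
    cases m with
    | zero => rfl
    | succ m => simp [muAux, IndecSub]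
  intro n
  induction n with
  | zero => intro m N hn _; rw [hbot m N hn]; rfl
  | succ n ih =>
    intro m N hn hm
    cases m with
    | zero => rw [hbot _ N hm, hbot _ N hm]
    | succ m =>
      simp only [muAux]
      congr 2
      refine Set.image_congr fun N' hN' => ?_
      have := subLen_lt_subLen hN'
      exact ih m N' (by omega) (by omega)

lemma two_mul_pow_le {m n : ℕ} (h : m < n) :
    2 * (2 : ℝ) ^ (-(n : ℤ)) ≤ (2 : ℝ) ^ (-(m : ℤ)) := by
  rw [← zpow_one_add₀ two_ne_zero]
  exact zpow_le_zpow_right₀ one_le_two (by omega)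

lemma muAux_nonneg (n : ℕ) (N : Submodule Λ Y) : 0 ≤ muAux Λ n N := by
  induction n generalizing N with
  | zero => exact le_rfl
  | succ n ih =>
    refine add_nonneg (by split_ifs <;> positivity) (Real.sSup_nonneg ?_)
    rintro _ ⟨N', -, rfl⟩
    exact ih N'

lemma muAux_le (n : ℕ) (N : Submodule Λ Y) : muAux Λ n N ≤ n := by
  induction n generalizing N with
  | zero => exact le_of_eq (by simp [muAux])
  | succ n ih =>
    have h1 : sSup (muAux Λ n '' {N' : Submodule Λ Y | N' < N}) ≤ n := by
      refine Real.sSup_le ?_ n.cast_nonneg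
      rintro _ ⟨N', -, rfl⟩
      exact ih N'
    have h2 : (2 : ℝ) ^ (-(subLen Λ N : ℤ)) ≤ 1 := zpow_le_one_of_nonpos₀ one_le_two (by omega)
    rw [muAux]
    push_cast
    split_ifs <;> linarith

/-- The values of the Gabriel-Roiter measure are dyadic, with denominator bounded by the length. -/
lemma exists_two_pow_mul_muAux_eq [IsNoetherian Λ Y] [IsArtinian Λ Y] (n m : ℕ)
    (N : Submodule Λ Y) (h : subLen Λ N ≤ m) : ∃ a : ℕ, 2 ^ m * muAux Λ n N = a := by
  induction n generalizing N with
  | zero => exact ⟨0, by simp [muAux]⟩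
  | succ n ih =>
    have h1 : ∃ a : ℕ, (2 : ℝ) ^ m * sSup (muAux Λ n '' {N' : Submodule Λ Y | N' < N}) = a := by
      rcases Set.eq_empty_or_nonempty {N' : Submodule Λ Y | N' < N} with he | hne
      · exact ⟨0, by simp [he]⟩
      · have hfin : (muAux Λ n '' {N' : Submodule Λ Y | N' < N}).Finite := by
          refine ((Set.finite_Iic (2 ^ m * n)).image (fun a : ℕ => (a : ℝ) / 2 ^ m)).subset ?_
          rintro _ ⟨N', hN', rfl⟩
          obtain ⟨a, ha⟩ := ih N' ((subLen_lt_subLen hN').le.trans h)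
          refine ⟨a, ?_, ?_⟩
          · have : (a : ℝ) ≤ 2 ^ m * n := by
              rw [← ha]; gcongr; exact muAux_le n N'
            exact_mod_cast this
          · simp only [← ha]; field_simp
        obtain ⟨N', hN', e⟩ := (hne.image (muAux Λ n)).csSup_mem hfin
        rw [← e]
        exact ih N' ((subLen_lt_subLen hN').le.trans h)
    obtain ⟨a, ha⟩ := h1
    rw [muAux, mul_add, ha]
    split_ifs
    · refine ⟨2 ^ (m - subLen Λ N) + a, ?_⟩
      push_cast
      congr 1
      rw [zpow_neg, zpow_natCast, pow_sub₀ _ two_ne_zero h]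
    · exact ⟨a, by simp⟩

lemma mu_nonneg (N : Submodule Λ Y) : 0 ≤ mu Λ N := muAux_nonneg _ N

lemma indecMod_coe_iff (N : Submodule Λ Y) : IndecMod Λ N ↔ IndecSub Λ N := by
  rw [IndecMod, ← indecSub_map_iff N.subtype N.injective_subtype, Submodule.map_top,
    Submodule.range_subtype]

lemma subLen_top_coe (N : Submodule Λ Y) : subLen Λ (⊤ : Submodule Λ N) = subLen Λ N := by
  rw [subLen_top, subLen_eq_length_toNat]

/-- A nonzero decomposable module has two complementary nonzero submodules. -/
lemma exists_isCompl_of_not_indecMod (h0 : (⊤ : Submodule Λ Y) ≠ ⊥) (h : ¬ IndecMod Λ Y) :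
    ∃ A B : Submodule Λ Y, IsCompl A B ∧ A ≠ ⊥ ∧ B ≠ ⊥ := by
  have h : ¬ ∀ A B : Submodule Λ Y, A ≤ ⊤ → B ≤ ⊤ → A ⊔ B = ⊤ → A ⊓ B = ⊥ →
      A = ⊥ ∨ B = ⊥ := fun h' => h ⟨h0, h'⟩
  push Not at h
  obtain ⟨A, B, -, -, hs, hi, hA, hB⟩ := h
  exact ⟨A, B, ⟨disjoint_iff.2 hi, codisjoint_iff.2 hs⟩, hA, hB⟩

section FiniteLength

variable [IsNoetherian Λ Y] [IsArtinian Λ Y]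

lemma finite_image_mu (S : Set (Submodule Λ Y)) : (mu Λ '' S).Finite := by
  set m := subLen Λ (⊤ : Submodule Λ Y)
  have hm : ∀ N : Submodule Λ Y, subLen Λ N ≤ m := fun N =>
    ENat.toNat_le_toNat (Order.height_mono le_top) (Submodule.height_lt_top _).ne
  refine ((Set.finite_Iic (2 ^ m * m)).image (fun a : ℕ => (a : ℝ) / 2 ^ m)).subset ?_
  rintro _ ⟨N, -, rfl⟩
  rw [← muAux_eq_mu m N (hm N)]
  obtain ⟨a, ha⟩ := exists_two_pow_mul_muAux_eq m m N (hm N)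
  refine ⟨a, ?_, ?_⟩
  · have : (a : ℝ) ≤ 2 ^ m * m := by
      rw [← ha]; gcongr; exact muAux_le m N
    exact_mod_cast this
  · simp only [← ha]; field_simp

open Classical in
lemma mu_eq (N : Submodule Λ Y) :
    mu Λ N = (if IndecSub Λ N then (2 : ℝ) ^ (-(subLen Λ N : ℤ)) else 0) +
      sSup (mu Λ '' {N' : Submodule Λ Y | N' < N}) := by
  rw [← muAux_eq_mu _ N (Nat.le_succ _), muAux]
  congr 2
  exact Set.image_congr fun N' hN' => muAux_eq_mu _ N' (subLen_lt_subLen hN').le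

lemma le_sSup_mu {N N' : Submodule Λ Y} (h : N' < N) :
    mu Λ N' ≤ sSup (mu Λ '' {N' : Submodule Λ Y | N' < N}) :=
  le_csSup (finite_image_mu _).bddAbove ⟨N', h, rfl⟩

lemma exists_mu_eq_sSup {N : Submodule Λ Y} (h : N ≠ ⊥) :
    ∃ N' < N, mu Λ N' = sSup (mu Λ '' {N' : Submodule Λ Y | N' < N}) := by
  have hne : {N' : Submodule Λ Y | N' < N}.Nonempty := ⟨⊥, bot_lt_iff_ne_bot.2 h⟩
  exact (hne.image _).csSup_mem (finite_image_mu _)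

lemma mu_mono {N N' : Submodule Λ Y} (h : N' ≤ N) : mu Λ N' ≤ mu Λ N := by
  rcases h.eq_or_lt with rfl | h
  · exact le_rfl
  · rw [mu_eq N]
    have := le_sSup_mu h
    split_ifs <;> linarith [zpow_pos (two_pos (α := ℝ)) (-(subLen Λ N : ℤ))]

lemma mu_add_le_of_lt {N N' : Submodule Λ Y} (hN : IndecSub Λ N) (h : N' < N) :
    mu Λ N' + (2 : ℝ) ^ (-(subLen Λ N : ℤ)) ≤ mu Λ N := by
  rw [mu_eq N, if_pos hN]
  linarith [le_sSup_mu h]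

lemma mu_bot : mu Λ (⊥ : Submodule Λ Y) = 0 := by
  rw [mu_eq]
  simp [IndecSub]

/-- Every submodule contains an indecomposable submodule of the same Gabriel-Roiter measure,
unless it vanishes. -/
lemma exists_indecSub_mu_eq (N : Submodule Λ Y) (hN : N ≠ ⊥) :
    ∃ X ≤ N, IndecSub Λ X ∧ mu Λ X = mu Λ N := by
  induction N using WellFoundedLT.induction with
  | ind N ih =>
    by_cases hind : IndecSub Λ N
    · exact ⟨N, le_rfl, hind, rfl⟩
    have hmu := mu_eq N
    rw [if_neg hind, zero_add] at hmu
    obtain ⟨N', hN', e⟩ := exists_mu_eq_sSup hN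
    by_cases hbot : N' = ⊥
    · have h : ¬ ∀ A B : Submodule Λ Y, A ≤ N → B ≤ N → A ⊔ B = N → A ⊓ B = ⊥ →
          A = ⊥ ∨ B = ⊥ := fun h => hind ⟨hN, h⟩
      push Not at h
      obtain ⟨A, B, hA, hB, hs, hi, hA0, hB0⟩ := h
      have hlt : A < N := by
        refine lt_of_le_of_ne hA ?_
        rintro rfl
        exact hB0 (by rw [← hi, inf_eq_right.2 hB])
      obtain ⟨X, hXA, hX, hXmu⟩ := ih A hlt hA0
      refine ⟨X, hXA.trans hA, hX, le_antisymm (mu_mono (hXA.trans hA)) ?_⟩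
      rw [hmu, ← e, hbot, mu_bot]
      exact mu_nonneg X
    · obtain ⟨X, hXN, hX, hXmu⟩ := ih N' hN' hbot
      exact ⟨X, hXN.trans hN'.le, hX, by rw [hXmu, hmu, e]⟩

lemma mu_pos {N : Submodule Λ Y} (hN : N ≠ ⊥) : 0 < mu Λ N := by
  obtain ⟨X, -, hX, e⟩ := exists_indecSub_mu_eq N hN
  have := mu_add_le_of_lt hX (bot_lt_iff_ne_bot.2 hX.1)
  rw [mu_bot, zero_add] at this
  rw [← e]
  exact (zpow_pos two_pos _).trans_le this

/-- An indecomposable module is either simple, in which case all its nonzero submodules are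
everything, or has a Gabriel-Roiter submodule. -/
lemma exists_mu_top_eq_add (hY : IndecMod Λ Y) :
    (∀ N : Submodule Λ Y, N ≠ ⊥ → N = ⊤) ∨
      ∃ X : Submodule Λ Y, X ≠ ⊤ ∧ IndecSub Λ X ∧
        mu Λ (⊤ : Submodule Λ Y) = mu Λ X + (2 : ℝ) ^ (-(subLen Λ (⊤ : Submodule Λ Y) : ℤ)) := by
  refine or_iff_not_imp_left.2 fun h => ?_
  push Not at h
  obtain ⟨N, hN0, hN⟩ := h
  obtain ⟨N', hN', e⟩ := exists_mu_eq_sSup hY.1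
  have hbot : N' ≠ ⊥ := by
    rintro rfl
    have h1 := le_sSup_mu hN.lt_top
    rw [← e, mu_bot] at h1
    exact (mu_pos hN0).not_ge h1
  obtain ⟨X, hXN, hX, hXmu⟩ := exists_indecSub_mu_eq N' hbot
  refine ⟨X, (hXN.trans_lt hN').ne, hX, ?_⟩
  rw [mu_eq, if_pos (show IndecSub Λ (⊤ : Submodule Λ Y) from hY), hXmu, e, add_comm]

lemma subLen_top_quotient_lt {K : Submodule Λ Y} (hK : K ≠ ⊥) :
    subLen Λ (⊤ : Submodule Λ (Y ⧸ K)) < subLen Λ (⊤ : Submodule Λ Y) := by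
  have h := Submodule.length_quotient_lt K hK
  rw [← ENat.natCast_toNat (Module.length_ne_top (R := Λ) (M := Y)),
    ← ENat.natCast_toNat (Module.length_ne_top (R := Λ) (M := Y ⧸ K))] at h
  rw [subLen_top, subLen_top]
  exact_mod_cast h

/-- Every submodule `K` is a finite intersection of submodules `L` with indecomposable quotients
whose Gabriel-Roiter measures do not exceed that of the quotient by `K`. -/
lemma exists_finset_inf_eq (K : Submodule Λ Y) :
    ∃ T : Finset (Submodule Λ Y), T.inf id = K ∧ ∀ L ∈ T, IndecMod Λ (Y ⧸ L) ∧
      mu Λ (⊤ : Submodule Λ (Y ⧸ L)) ≤ mu Λ (⊤ : Submodule Λ (Y ⧸ K)) := by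
  classical
  induction K using WellFoundedGT.induction with
  | ind K ih =>
    by_cases hind : IndecMod Λ (Y ⧸ K)
    · exact ⟨{K}, by simp, by simpa using hind⟩
    by_cases h0 : (⊤ : Submodule Λ (Y ⧸ K)) = ⊥
    · refine ⟨∅, ?_, by simp⟩
      have h := congrArg (Submodule.comap K.mkQ) h0
      rwa [Submodule.comap_top, Submodule.comap_bot, Submodule.ker_mkQ] at h
    obtain ⟨A, B, hAB, hA, hB⟩ := exists_isCompl_of_not_indecMod h0 hind
    have key : ∀ A B : Submodule Λ (Y ⧸ K), IsCompl A B → A ≠ ⊥ →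
        ∃ T : Finset (Submodule Λ Y), T.inf id = A.comap K.mkQ ∧ ∀ L ∈ T, IndecMod Λ (Y ⧸ L) ∧
          mu Λ (⊤ : Submodule Λ (Y ⧸ L)) ≤ mu Λ (⊤ : Submodule Λ (Y ⧸ K)) := by
      intro A B hAB hA
      have hKA : K < A.comap K.mkQ := by
        refine lt_of_le_of_ne (Submodule.le_comap_mkQ K A) fun e => hA ?_
        have h := Submodule.map_comap_eq_of_surjective K.mkQ_surjective A
        rw [← e, Submodule.mkQ_map_self] at h
        exact h.symm
      obtain ⟨T, hT, hT'⟩ := ih _ hKA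
      refine ⟨T, hT, fun L hL => ⟨(hT' L hL).1, (hT' L hL).2.trans ?_⟩⟩
      have hker : LinearMap.ker ((B.projection A hAB.symm).comp K.mkQ) = A.comap K.mkQ := by
        rw [LinearMap.ker_comp, Submodule.ker_projection]
      rw [← hker, mu_top_quotient_ker]
      exact mu_mono le_top
    obtain ⟨T₁, h₁, h₁'⟩ := key A B hAB hA
    obtain ⟨T₂, h₂, h₂'⟩ := key B A hAB.symm hB
    refine ⟨T₁ ∪ T₂, ?_, fun L hL => (Finset.mem_union.1 hL).elim (h₁' L) (h₂' L)⟩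
    rw [Finset.inf_union, h₁, h₂, ← Submodule.comap_inf, hAB.inf_eq_bot, Submodule.comap_bot,
      Submodule.ker_mkQ]

end FiniteLength

/-- If an indecomposable module `Y` embeds into a finite direct sum of quotients of `Y` whose
Gabriel-Roiter measures are less than `μ(Y) + 2^(-|Y|)`, then one of the quotients is `Y`. -/
theorem bot_mem_of_inf_eq_bot {Y : Type v} [AddCommGroup Y] [Module Λ Y]
    [IsNoetherian Λ Y] [IsArtinian Λ Y] (hY : IndecMod Λ Y) (S : Finset (Submodule Λ Y))
    (hS : S.inf id = ⊥)
    (hmu : ∀ K ∈ S, mu Λ (⊤ : Submodule Λ (Y ⧸ K)) <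
      mu Λ (⊤ : Submodule Λ Y) + (2 : ℝ) ^ (-(subLen Λ (⊤ : Submodule Λ Y) : ℤ))) :
    ⊥ ∈ S := by
  classical
  induction hn : subLen Λ (⊤ : Submodule Λ Y) using Nat.strong_induction_on
    generalizing Y with
  | _ n ih =>
  subst hn
  choose T hT hT' using fun K : Submodule Λ Y => exists_finset_inf_eq K
  suffices h : ⊥ ∈ S.biUnion T by
    obtain ⟨K, hK, hbot⟩ := Finset.mem_biUnion.1 h
    have hK0 : K = ⊥ := by
      rw [← hT K]
      exact le_bot_iff.1 (Finset.inf_le hbot)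
    exact hK0 ▸ hK
  have hS' : (S.biUnion T).inf id = ⊥ := by
    rw [Finset.inf_biUnion, ← hS]
    exact Finset.inf_congr rfl fun K _ => hT K
  have hmu' : ∀ L ∈ S.biUnion T, IndecMod Λ (Y ⧸ L) ∧ mu Λ (⊤ : Submodule Λ (Y ⧸ L)) <
      mu Λ (⊤ : Submodule Λ Y) + (2 : ℝ) ^ (-(subLen Λ (⊤ : Submodule Λ Y) : ℤ)) := by
    intro L hL
    obtain ⟨K, hK, hLK⟩ := Finset.mem_biUnion.1 hL
    exact ⟨(hT' K L hLK).1, (hT' K L hLK).2.trans_lt (hmu K hK)⟩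
  generalize S.biUnion T = S' at hS' hmu'
  by_contra hbot
  rcases exists_mu_top_eq_add hY with hsimple | ⟨X, hXtop, hX, hXmu⟩
  · refine hY.1 (eq_bot_iff.2 (hS' ▸ Finset.le_inf fun K hK => ?_))
    exact (hsimple K fun e => hbot (e ▸ hK)).ge
  have hlt := subLen_lt_subLen hXtop.lt_top
  let φ : ∀ K : Submodule Λ Y, X →ₗ[Λ] Y ⧸ K := fun K => K.mkQ.comp X.subtype
  have hker : ∀ K, LinearMap.ker (φ K) = K.comap X.subtype := fun K => by
    rw [LinearMap.ker_comp, Submodule.ker_mkQ]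
  have hmem : ⊥ ∈ S'.image fun K => LinearMap.ker (φ K) := by
    refine ih (subLen Λ X) hlt ((indecMod_coe_iff X).2 hX) _ ?_ ?_ (subLen_top_coe X)
    · rw [Finset.inf_image, eq_bot_iff]
      intro x hx
      have hx' : (x : Y) ∈ S'.inf id := by
        rw [Submodule.mem_finsetInf] at hx ⊢
        intro K hK
        have := hx K hK
        rwa [Function.comp_apply, id, hker] at this
      rw [hS', Submodule.mem_bot] at hx'
      simpa using hx'
    · intro L hL
      obtain ⟨K, hK, rfl⟩ := Finset.mem_image.1 hL
      rw [mu_top_quotient_ker, mu_top_coe, subLen_top_coe]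
      have h1 := (hmu' K hK).2
      have h2 := mu_mono (Λ := Λ) (le_top : LinearMap.range (φ K) ≤ ⊤)
      have h3 := two_mul_pow_le hlt
      linarith
  obtain ⟨K, hK, hKX⟩ := Finset.mem_image.1 hmem
  have hinj : Function.Injective (φ K) := LinearMap.ker_eq_bot.1 hKX
  have hinf : X ⊓ K = ⊥ := by
    have h := congrArg (Submodule.map X.subtype) hKX
    rwa [hker, Submodule.map_comap_subtype, Submodule.map_bot] at h
  have hK0 : K ≠ ⊥ := fun e => hbot (e ▸ hK)
  have hrange : LinearMap.range (φ K) < ⊤ := by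
    refine lt_top_iff_ne_top.2 fun e => ?_
    have hsup : X ⊔ K = ⊤ := by
      rw [LinearMap.range_comp, Submodule.range_subtype] at e
      have h := congrArg (Submodule.comap K.mkQ) e
      rwa [Submodule.comap_map_mkQ, Submodule.comap_top, sup_comm] at h
    exact (hY.2 X K le_top le_top hsup hinf).elim hX.1 hK0
  have h1 := mu_add_le_of_lt (hmu' K hK).1 hrange
  have h2 := (hmu' K hK).2
  have h3 := two_mul_pow_le (subLen_top_quotient_lt hK0)
  rw [← mu_top_eq_mu_range (φ K) hinj, mu_top_coe] at h1
  linarith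

/-- If an indecomposable module `X` embeds jointly into finitely many modules by maps whose images
have Gabriel-Roiter measure at most `μ(X)`, then one of the maps is injective. -/
theorem exists_injective_of_iInf_ker_eq_bot {X : Type v} [AddCommGroup X] [Module Λ X]
    [IsNoetherian Λ X] [IsArtinian Λ X] (hX : IndecMod Λ X) {ι : Type*} [Finite ι]
    {N : ι → Type v} [∀ i, AddCommGroup (N i)] [∀ i, Module Λ (N i)] (φ : ∀ i, X →ₗ[Λ] N i)
    (hφ : ⨅ i, LinearMap.ker (φ i) = ⊥)
    (hmu : ∀ i, mu Λ (LinearMap.range (φ i)) ≤ mu Λ (⊤ : Submodule Λ X)) :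
    ∃ i, Function.Injective (φ i) := by
  classical
  cases nonempty_fintype ι
  have h : ⊥ ∈ Finset.univ.image fun i => LinearMap.ker (φ i) := by
    refine bot_mem_of_inf_eq_bot hX _ ?_ ?_
    · rw [Finset.inf_image, ← hφ, Finset.inf_univ_eq_iInf]
      rfl
    · intro K hK
      obtain ⟨i, -, rfl⟩ := Finset.mem_image.1 hK
      rw [mu_top_quotient_ker]
      exact (hmu i).trans_lt (lt_add_of_pos_right _ (zpow_pos two_pos _))
  obtain ⟨i, -, hi⟩ := Finset.mem_image.1 h
  exact ⟨i, LinearMap.ker_eq_bot.1 hi⟩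

/-- A monomorphism from an indecomposable module `X` to a module `W` with `μ(W) ≤ μ(X)` splits. -/
theorem isSplitMonoHom_of_mu_le {X W : Type v} [AddCommGroup X] [Module Λ X]
    [IsNoetherian Λ X] [IsArtinian Λ X] (hX : IndecMod Λ X) [AddCommGroup W] [Module Λ W]
    [IsNoetherian Λ W] [IsArtinian Λ W] (φ : X →ₗ[Λ] W) (hφ : Function.Injective φ)
    (hmu : mu Λ (⊤ : Submodule Λ W) ≤ mu Λ (⊤ : Submodule Λ X)) :
    IsSplitMonoHom Λ φ := by
  induction hn : subLen Λ (⊤ : Submodule Λ W) using Nat.strong_induction_on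
    generalizing W with
  | _ n ih =>
  subst hn
  by_cases hW : IndecMod Λ W
  · have hsurj : LinearMap.range φ = ⊤ := by
      by_contra hne
      have h1 := mu_add_le_of_lt hW (lt_top_iff_ne_top.2 hne)
      rw [← mu_top_eq_mu_range φ hφ] at h1
      linarith [zpow_pos (two_pos (α := ℝ)) (-(subLen Λ (⊤ : Submodule Λ W) : ℤ))]
    let e := LinearEquiv.ofBijective φ ⟨hφ, LinearMap.range_eq_top.1 hsurj⟩
    exact ⟨e.symm, LinearMap.ext fun x => e.symm_apply_apply x⟩
  have h0 : (⊤ : Submodule Λ W) ≠ ⊥ := by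
    intro e
    refine hX.1 (eq_bot_iff.2 fun x _ => (Submodule.mem_bot Λ).2 (hφ ?_))
    rw [map_zero, ← Submodule.mem_bot Λ, ← e]
    exact Submodule.mem_top
  obtain ⟨A, B, hAB, hA, hB⟩ := exists_isCompl_of_not_indecMod h0 hW
  have key : ∀ A B : Submodule Λ W, ∀ hAB : IsCompl A B, B ≠ ⊥ →
      Function.Injective ((A.projection B hAB).comp φ) → IsSplitMonoHom Λ φ := by
    intro A B hAB hB hinj
    have hlt : A < ⊤ := by
      refine lt_top_iff_ne_top.2 ?_
      rintro rfl
      exact hB (by simpa using hAB.inf_eq_bot)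
    have hinj' : Function.Injective ((A.projectionOnto B hAB).comp φ) := fun x y hxy =>
      hinj (congrArg Subtype.val hxy)
    obtain ⟨g, hg⟩ := ih (subLen Λ A) (subLen_lt_subLen hlt) _ hinj'
      ((mu_top_coe A).trans_le ((mu_mono le_top).trans hmu)) (subLen_top_coe A)
    exact ⟨g.comp (A.projectionOnto B hAB), hg⟩
  obtain ⟨i, hi⟩ := exists_injective_of_iInf_ker_eq_bot hX (N := fun _ : Bool => W)
    (fun b => (if b then A.projection B hAB else B.projection A hAB.symm).comp φ) (by
      refine eq_bot_iff.2 fun x hx => (Submodule.mem_bot Λ).2 (hφ ?_)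
      rw [Submodule.mem_iInf] at hx
      have h1 := hx true
      have h2 := hx false
      simp only [if_true, Bool.false_eq_true, if_false, LinearMap.mem_ker,
        LinearMap.comp_apply] at h1 h2
      rw [map_zero, ← Submodule.projection_add_projection_eq_self hAB (φ x), h1, h2, add_zero])
    (fun b => (mu_mono le_top).trans hmu)
  cases i
  · exact key B A hAB.symm hA hi
  · exact key A B hAB hB hi

end GabrielRoiterMeasure

/-- Let `X ⊂ Y` be a Gabriel-Roiter inclusion and let
`f = (f_i)_i : X → ⊕_{i=1}^t M_i` be a source map for `X` with all `M_i` indecomposable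
(the direct sum is realized as the product `(i : Fin t) → M i`, and `f_i` is the `i`-th
component `proj i ∘ f`). Assume the components `f_i` for `i < r` are monomorphisms and the
remaining ones are not. Then there exist an index `i < r` and an epimorphism `g : M_i → Y`
such that `g ∘ f_i : X → Y` is a monomorphism. -/
theorem gabriel_roiter_stmt1
    (k : Type u) [CommRing k] [IsArtinianRing k]
    (Λ : Type u) [Ring Λ] [Algebra k Λ] [Module.Finite k Λ]
    (Y : Type v) [AddCommGroup Y] [Module Λ Y] (hYfl : IsFiniteLength Λ Y)
    (X : Submodule Λ Y) (hX : IsGRSub Λ X)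
    (t : ℕ) (M : Fin t → Type v) [∀ i, AddCommGroup (M i)] [∀ i, Module Λ (M i)]
    (hMfl : ∀ i, IsFiniteLength Λ (M i)) (hMindec : ∀ i, IndecMod Λ (M i))
    (f : ↥X →ₗ[Λ] ((i : Fin t) → M i)) (hf : IsSourceMap Λ f)
    (r : ℕ) (hrt : r ≤ t)
    (hmono : ∀ i : Fin t, (i : ℕ) < r →
      Function.Injective ((LinearMap.proj i).comp f))
    (hnotmono : ∀ i : Fin t, r ≤ (i : ℕ) →
      ¬ Function.Injective ((LinearMap.proj i).comp f)) :
    ∃ i : Fin t, (i : ℕ) < r ∧ ∃ g : M i →ₗ[Λ] Y, Function.Surjective g ∧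
      Function.Injective (g.comp ((LinearMap.proj i).comp f)) := by
  obtain ⟨hYnoeth, hYart⟩ := isFiniteLength_iff_isNoetherian_isArtinian.1 hYfl
  obtain ⟨hYind, hXind, hXtop, hXmu⟩ := hX
  have hXmod : IndecMod Λ X := (indecMod_coe_iff X).2 hXind
  have hproper : ∀ N : Submodule Λ Y, N ≠ ⊤ → mu Λ N ≤ mu Λ (⊤ : Submodule Λ X) := by
    intro N hN
    have h := mu_add_le_of_lt hYind hN.lt_top
    rw [mu_top_coe]
    linarith
  have hsplit : ¬ IsSplitMonoHom Λ X.subtype := by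
    rintro ⟨p, hp⟩
    have hcompl : IsCompl X (LinearMap.ker p) :=
      LinearMap.isCompl_of_proj fun x => LinearMap.congr_fun hp x
    rcases hYind.2 X (LinearMap.ker p) le_top le_top hcompl.sup_eq_top hcompl.inf_eq_bot with h | h
    · exact hXind.1 h
    · exact hXtop (by simpa [h] using hcompl.sup_eq_top)
  obtain ⟨h, hh⟩ := hf.2.1 Y hYfl X.subtype hsplit
  let c : ∀ i, M i →ₗ[Λ] Y := fun i => h.comp (LinearMap.single Λ M i)
  let φ : ∀ i, X →ₗ[Λ] Y := fun i => (c i).comp ((LinearMap.proj i).comp f)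
  have hsum : ∀ x : X, (x : Y) = ∑ i, φ i x := fun x => by
    have h1 : h (f x) = ∑ i, φ i x := by
      conv_lhs => rw [← LinearMap.sum_single_apply M (f x)]
      rw [map_sum]
      rfl
    rw [← h1]
    exact LinearMap.congr_fun hh x
  have hker : ⨅ i, LinearMap.ker (φ i) = ⊥ := by
    refine eq_bot_iff.2 fun x hx => ?_
    rw [Submodule.mem_iInf] at hx
    rw [Submodule.mem_bot, ← Submodule.coe_eq_zero, hsum x]
    exact Finset.sum_eq_zero fun i _ => hx i
  obtain ⟨i, hi⟩ := exists_injective_of_iInf_ker_eq_bot hXmod φ hker fun i => by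
    refine hproper _ fun e => ?_
    have h1 := Module.length_le_of_surjective (φ i) (LinearMap.range_eq_top.1 e)
    exact h1.not_gt (Submodule.length_lt hXtop)
  have hfi : Function.Injective ((LinearMap.proj i).comp f) := fun x y hxy =>
    hi (congrArg (c i) hxy)
  refine ⟨i, not_le.1 fun hri => hnotmono i hri hfi, c i, ?_, hi⟩
  by_contra hsurj
  have hrange : LinearMap.range (c i) ≠ ⊤ := fun e => hsurj (LinearMap.range_eq_top.1 e)
  obtain ⟨g, hg⟩ := isSplitMonoHom_of_mu_le hXmod
    ((c i).rangeRestrict.comp ((LinearMap.proj i).comp f))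
    (fun x y hxy => hi (congrArg Subtype.val hxy))
    ((mu_top_coe _).trans_le (hproper _ hrange))
  exact hf.1 ⟨(g.comp (c i).rangeRestrict).comp (LinearMap.proj i), hg⟩
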